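/- (Shift decomposition) Let f : T^d_L → C with Fourier coefficients supported in J_1 ∪ ... ∪ J_n, where each J_l ⊂ R^d is an axis-parallel parallelepiped with sides b_1,...,b_d centered at λ_l, and assume the centers satisfy |λ_{l,j} - λ_{k,j}| > 2b_j for all l ≠ k and all j. Then there exist functions f_1, ..., f_n on T^d_L and lattice points c_l ∈ (Z/L)^d ∩ J_l such that f(x) = Σ_{l=1}^n f_l(x) e^{i c_l · x}, each f̂_l is supported in [-b_1, b_1] × ... × [-b_d, b_d], and for all p ∈ [1,∞]: ‖f_l‖_{L^p(T^d_L)} ≤ 6^d ‖f‖_{L^p(T^d_L)}. -/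

import Mathlib

open MeasureTheory Real

/-- The trigonometric polynomial on `T^d_L` with Fourier coefficients `F` supported on `T`. -/
noncomputable def trigPoly {d : ℕ} (L : ℝ) (T : Finset (Fin d → ℤ)) (F : (Fin d → ℤ) → ℂ) :
    (Fin d → ℝ) → ℂ :=
  fun x => ∑ k ∈ T, F k * Complex.exp (Complex.I * ((∑ j, x j * (k j : ℝ) / L : ℝ) : ℂ))

/-- The fundamental domain `[0, 2πL]^d` of the torus `T^d_L`. -/
def torusCube (d : ℕ) (L : ℝ) : Set (Fin d → ℝ) :=
  Set.univ.pi fun _ : Fin d => Set.Icc (0 : ℝ) (2 * π * L)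

/-- The character `x ↦ exp (i x · k / L)` of `T^d_L`. -/
noncomputable def torusChar {d : ℕ} (L : ℝ) (k : Fin d → ℤ) (x : Fin d → ℝ) : ℂ :=
  Complex.exp (Complex.I * ((∑ j, x j * (k j : ℝ) / L : ℝ) : ℂ))

section TorusChar

variable {d : ℕ} (L : ℝ)

lemma torusChar_add (k m : Fin d → ℤ) (x : Fin d → ℝ) :
    torusChar L (k + m) x = torusChar L k x * torusChar L m x := by
  simp only [torusChar, ← Complex.exp_add, ← mul_add, ← Complex.ofReal_add,
    ← Finset.sum_add_distrib]
  congr 3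
  refine Finset.sum_congr rfl fun j _ => ?_
  push_cast [Pi.add_apply]
  ring

lemma torusChar_apply_add (k : Fin d → ℤ) (x y : Fin d → ℝ) :
    torusChar L k (x + y) = torusChar L k x * torusChar L k y := by
  simp only [torusChar, ← Complex.exp_add, ← mul_add, ← Complex.ofReal_add,
    ← Finset.sum_add_distrib]
  congr 3
  refine Finset.sum_congr rfl fun j _ => ?_
  rw [Pi.add_apply]
  ring

@[simp]
lemma torusChar_zero (x : Fin d → ℝ) : torusChar L 0 x = 1 := by
  simp [torusChar]

lemma norm_torusChar (k : Fin d → ℤ) (x : Fin d → ℝ) : ‖torusChar L k x‖ = 1 := by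
  rw [torusChar, mul_comm, Complex.norm_exp_ofReal_mul_I]

lemma conj_torusChar (k : Fin d → ℤ) (x : Fin d → ℝ) :
    (starRingEnd ℂ) (torusChar L k x) = torusChar L (-k) x := by
  simp [torusChar, ← Complex.exp_conj, neg_div]

lemma continuous_trigPoly (T : Finset (Fin d → ℤ)) (F : (Fin d → ℤ) → ℂ) :
    Continuous (trigPoly L T F) := by
  unfold trigPoly
  fun_prop

lemma trigPoly_eq_sum_torusChar (T : Finset (Fin d → ℤ)) (F : (Fin d → ℤ) → ℂ)
    (x : Fin d → ℝ) : trigPoly L T F x = ∑ k ∈ T, F k * torusChar L k x := rfl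

end TorusChar

lemma sum_exp_eq_zero {N : ℕ} (hN : 0 < N) {m : ℤ} (hm : ¬ (N : ℤ) ∣ m) :
    ∑ s ∈ Finset.range N, Complex.exp (2 * π * Complex.I * (m / N)) ^ s = 0 := by
  have hN' : (N : ℂ) ≠ 0 := by exact_mod_cast hN.ne'
  have h1 : Complex.exp (2 * π * Complex.I * (m / N)) ≠ 1 := by
    rw [Ne, Complex.exp_eq_one_iff]
    rintro ⟨n, hn⟩
    have h2 : (2 * π * Complex.I : ℂ) ≠ 0 := Complex.two_pi_I_ne_zero
    rw [mul_comm (n : ℂ)] at hn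
    have h3 := mul_left_cancel₀ h2 hn
    rw [div_eq_iff hN'] at h3
    exact hm ⟨n, by rw [mul_comm]; exact_mod_cast h3⟩
  rw [geom_sum_eq h1, ← Complex.exp_nat_mul]
  rw [show (N : ℂ) * (2 * π * Complex.I * (m / N)) = m * (2 * π * Complex.I) by field_simp]
  rw [Complex.exp_int_mul_two_pi_mul_I]
  simp

/-- Finitely many characters are orthogonal with respect to sampling on a fine enough grid. -/
lemma exists_sum_torusChar_eq_ite {d : ℕ} {L : ℝ} (hL : 0 < L) (M : Finset (Fin d → ℤ)) :
    ∃ A : Finset (Fin d → ℕ), A.Nonempty ∧ ∃ τ : (Fin d → ℕ) → Fin d → ℝ,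
      ∀ m ∈ M, ∑ t ∈ A, torusChar L m (τ t) = if m = 0 then (A.card : ℂ) else 0 := by
  obtain ⟨N, hN, hNM⟩ : ∃ N : ℕ, 0 < N ∧ ∀ m ∈ M, (∀ j, (N : ℤ) ∣ m j) → m = 0 := by
    refine ⟨1 + ∑ m ∈ M, ∑ j, (m j).natAbs, by omega, fun m hm h => funext fun j => ?_⟩
    refine Int.eq_zero_of_abs_lt_dvd (h j) ?_
    have h1 : (m j).natAbs ≤ ∑ j, (m j).natAbs :=
      Finset.single_le_sum (f := fun j => (m j).natAbs) (fun _ _ => Nat.zero_le _)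
        (Finset.mem_univ j)
    have h2 : ∑ j, (m j).natAbs ≤ ∑ m ∈ M, ∑ j, (m j).natAbs :=
      Finset.single_le_sum (f := fun m : Fin d → ℤ => ∑ j, (m j).natAbs)
        (fun _ _ => Nat.zero_le _) hm
    zify at h1 h2 ⊢
    omega
  refine ⟨Fintype.piFinset fun _ => Finset.range N, ?_,
    fun t j => 2 * π * L * t j / N, fun m hm => ?_⟩
  · exact ⟨0, by simp [hN]⟩
  split_ifs with h0
  · simp [h0]
  have hprod : ∀ t : Fin d → ℕ, torusChar L m (fun j => 2 * π * L * t j / N) =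
      ∏ j, Complex.exp (2 * π * Complex.I * (m j / N)) ^ t j := by
    intro t
    have hL' : (L : ℂ) ≠ 0 := by exact_mod_cast hL.ne'
    simp only [torusChar, ← Complex.exp_nat_mul, ← Complex.exp_sum]
    push_cast
    rw [Finset.mul_sum]
    congr 1
    refine Finset.sum_congr rfl fun j _ => ?_
    field_simp
  simp only [hprod]
  rw [← Finset.prod_univ_sum (fun _ => Finset.range N)
    (fun j s => Complex.exp (2 * π * Complex.I * (m j / N)) ^ s)]
  obtain ⟨j, hj⟩ : ∃ j, ¬ (N : ℤ) ∣ m j := by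
    by_contra! h
    exact h0 (hNM m hm h)
  exact Finset.prod_eq_zero (Finset.mem_univ j) (sum_exp_eq_zero hN hj)

lemma eLpNorm_trigPoly_comp_add_right {d : ℕ} {L : ℝ} (hL : 0 < L) (T : Finset (Fin d → ℤ))
    (F : (Fin d → ℤ) → ℂ) (τ : Fin d → ℝ) (p : ENNReal) :
    eLpNorm (fun x => trigPoly L T F (x + τ)) p (volume.restrict (torusCube d L)) =
      eLpNorm (trigPoly L T F) p (volume.restrict (torusCube d L)) := by
  have : Fact (0 < 2 * π * L) := ⟨by positivity⟩
  let proj : (Fin d → ℝ) → (Fin d → AddCircle (2 * π * L)) :=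
    fun x j => (x j : AddCircle (2 * π * L))
  let G : (Fin d → AddCircle (2 * π * L)) → ℂ := fun y => ∑ k ∈ T, F k * ∏ j, fourier (k j) (y j)
  have hG : Continuous G := by
    unfold G
    fun_prop
  have hfG : ∀ x, trigPoly L T F x = G (proj x) := by
    intro x
    refine Finset.sum_congr rfl fun k _ => ?_
    simp only [proj, fourier_coe_apply, ← Complex.exp_sum]
    congr 2
    push_cast
    rw [Finset.mul_sum]
    refine Finset.sum_congr rfl fun j _ => ?_
    have hL' : (L : ℂ) ≠ 0 := by exact_mod_cast hL.ne'
    have hpi : (π : ℂ) ≠ 0 := by exact_mod_cast Real.pi_ne_zero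
    field_simp
  have hmp : MeasurePreserving proj (volume.restrict (torusCube d L)) volume := by
    rw [torusCube, volume_pi, Measure.restrict_pi_pi, volume_pi]
    refine measurePreserving_pi _ _ fun j => ?_
    rw [← Measure.restrict_congr_set (Ioc_ae_eq_Icc (μ := volume))]
    simpa using AddCircle.measurePreserving_mk (2 * π * L) 0
  have hadd : MeasurePreserving (fun y : Fin d → AddCircle (2 * π * L) => y + proj τ)
      volume volume :=
    measurePreserving_add_right volume (proj τ)
  have h1 : (fun x => trigPoly L T F (x + τ)) = (G ∘ fun y => y + proj τ) ∘ proj := by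
    funext x
    exact hfG _
  have h2 : trigPoly L T F = G ∘ proj := funext hfG
  rw [h1, h2, eLpNorm_comp_measurePreserving (by fun_prop) hmp,
    eLpNorm_comp_measurePreserving (by fun_prop) hmp,
    eLpNorm_comp_measurePreserving (by fun_prop) hadd]

lemma sum_norm_sum_torusChar_sq {d : ℕ} {L : ℝ} {A : Finset (Fin d → ℕ)}
    {τ : (Fin d → ℕ) → Fin d → ℝ} {P : Finset (Fin d → ℤ)}
    (h : ∀ p ∈ P, ∀ q ∈ P, ∑ t ∈ A, torusChar L (p - q) (τ t) =
      if p - q = 0 then (A.card : ℂ) else 0) :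
    ∑ t ∈ A, ‖∑ p ∈ P, torusChar L (-p) (τ t)‖ ^ 2 = A.card * P.card := by
  have h1 : ∀ t, ((‖∑ p ∈ P, torusChar L (-p) (τ t)‖ ^ 2 : ℝ) : ℂ) =
      ∑ p ∈ P, ∑ q ∈ P, torusChar L (p - q) (τ t) := by
    intro t
    push_cast
    rw [← Complex.conj_mul', map_sum, Finset.sum_mul_sum]
    simp only [conj_torusChar, neg_neg, sub_eq_add_neg, torusChar_add]
  rw [← Complex.ofReal_inj]
  push_cast
  push_cast at h1
  simp only [h1]
  rw [Finset.sum_comm]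
  have h2 : ∀ p ∈ P, ∑ t ∈ A, ∑ q ∈ P, torusChar L (p - q) (τ t) = A.card := by
    intro p hp
    rw [Finset.sum_comm, Finset.sum_congr rfl fun q hq => h p hp q hq]
    simp [sub_eq_zero, hp]
  rw [Finset.sum_congr rfl h2, Finset.sum_const, nsmul_eq_mul, mul_comm]

/-- The multiplier `1_P * 1_Q / |Q|`, a de la Vallée Poussin kernel, is bounded on every `L^p`. -/
lemma eLpNorm_trigPoly_subset_le {d : ℕ} {L : ℝ} (hL : 0 < L) {S T : Finset (Fin d → ℤ)}
    (hST : S ⊆ T) (F : (Fin d → ℤ) → ℂ) {P Q : Finset (Fin d → ℤ)} (hQ : Q.Nonempty)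
    (hin : ∀ k ∈ S, ∀ q ∈ Q, k - q ∈ P) (hout : ∀ k ∈ T, k ∉ S → ∀ q ∈ Q, k - q ∉ P)
    {p : ENNReal} (hp : 1 ≤ p) :
    eLpNorm (trigPoly L S F) p (volume.restrict (torusCube d L)) ≤
      ENNReal.ofReal ((P.card + Q.card) / (2 * Q.card)) *
        eLpNorm (trigPoly L T F) p (volume.restrict (torusCube d L)) := by
  classical
  obtain ⟨A, hA, τ, hτ⟩ := exists_sum_torusChar_eq_ite hL
    (((T ×ˢ P ×ˢ Q).image fun x => x.1 - x.2.1 - x.2.2) ∪ ((P ×ˢ P).image fun x => x.1 - x.2) ∪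
      ((Q ×ˢ Q).image fun x => x.1 - x.2))
  have hA0 : (0 : ℝ) < A.card := by exact_mod_cast hA.card_pos
  have hQ0 : (0 : ℝ) < Q.card := by exact_mod_cast hQ.card_pos
  have hAC : (A.card : ℂ) ≠ 0 := by exact_mod_cast hA.card_pos.ne'
  have hQC : (Q.card : ℂ) ≠ 0 := by exact_mod_cast hQ.card_pos.ne'
  let D : Finset (Fin d → ℤ) → (Fin d → ℕ) → ℂ := fun R t => ∑ r ∈ R, torusChar L (-r) (τ t)
  let w : (Fin d → ℕ) → ℂ := fun t => (A.card * Q.card : ℂ)⁻¹ * (D P t * D Q t)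
  have hDP : ∑ t ∈ A, ‖D P t‖ ^ 2 = A.card * P.card :=
    sum_norm_sum_torusChar_sq fun a ha b hb => hτ _ <| Finset.mem_union_left _ <|
      Finset.mem_union_right _ <| Finset.mem_image.2 ⟨(a, b), by simp [ha, hb], rfl⟩
  have hDQ : ∑ t ∈ A, ‖D Q t‖ ^ 2 = A.card * Q.card :=
    sum_norm_sum_torusChar_sq fun a ha b hb => hτ _ <|
      Finset.mem_union_right _ <| Finset.mem_image.2 ⟨(a, b), by simp [ha, hb], rfl⟩
  have hw : ∑ t ∈ A, ‖w t‖ ≤ (P.card + Q.card) / (2 * Q.card) := by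
    have h1 : ∀ t, ‖w t‖ ≤ (A.card * Q.card : ℝ)⁻¹ * ((‖D P t‖ ^ 2 + ‖D Q t‖ ^ 2) / 2) := by
      intro t
      simp only [w, norm_mul, norm_inv, Complex.norm_natCast]
      gcongr
      nlinarith [sq_nonneg (‖D P t‖ - ‖D Q t‖)]
    refine (Finset.sum_le_sum fun t _ => h1 t).trans_eq ?_
    rw [← Finset.mul_sum, ← Finset.sum_div, Finset.sum_add_distrib, hDP, hDQ]
    field_simp
  have hcoef : ∀ k ∈ T, ∑ t ∈ A, w t * torusChar L k (τ t) = if k ∈ S then 1 else 0 := by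
    intro k hk
    have h1 : ∀ t, w t * torusChar L k (τ t) = (A.card * Q.card : ℂ)⁻¹ *
        ∑ q ∈ Q, ∑ p ∈ P, torusChar L (k - p - q) (τ t) := by
      intro t
      simp only [w, D, sub_eq_add_neg, torusChar_add]
      simp only [← Finset.mul_sum, ← Finset.sum_mul]
      ring
    simp only [h1]
    rw [← Finset.mul_sum, Finset.sum_comm]
    have h2 : ∀ q ∈ Q, ∑ t ∈ A, ∑ p ∈ P, torusChar L (k - p - q) (τ t) =
        if k ∈ S then (A.card : ℂ) else 0 := by
      intro q hq
      rw [Finset.sum_comm]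
      have h3 : ∀ p ∈ P, ∑ t ∈ A, torusChar L (k - p - q) (τ t) =
          if k - q = p then (A.card : ℂ) else 0 := by
        intro p hp
        rw [hτ _ (Finset.mem_union_left _ <| Finset.mem_union_left _ <|
          Finset.mem_image.2 ⟨(k, p, q), by simp [hk, hp, hq], rfl⟩), sub_right_comm]
        simp only [sub_eq_zero]
      rw [Finset.sum_congr rfl h3, Finset.sum_ite_eq]
      by_cases hkS : k ∈ S
      · simp [hkS, hin k hkS q hq]
      · simp [hkS, hout k hk hkS q hq]
    rw [Finset.sum_congr rfl h2, Finset.sum_const, nsmul_eq_mul]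
    split_ifs
    · field_simp
    · simp
  have hrep : trigPoly L S F = ∑ t ∈ A, w t • fun x => trigPoly L T F (x + τ t) := by
    funext x
    simp only [Finset.sum_apply, Pi.smul_apply, smul_eq_mul, trigPoly_eq_sum_torusChar,
      torusChar_apply_add, Finset.mul_sum]
    rw [Finset.sum_comm, ← Finset.sum_subset hST (f := fun k => ∑ t ∈ A, _)]
    · refine Finset.sum_congr rfl fun k hk => ?_
      calc F k * torusChar L k x = F k * torusChar L k x * ∑ t ∈ A, w t * torusChar L k (τ t) := by
            rw [hcoef k (hST hk), if_pos hk, mul_one]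
        _ = _ := by
            rw [Finset.mul_sum]
            exact Finset.sum_congr rfl fun t _ => by ring
    · intro k hk hkS
      calc _ = F k * torusChar L k x * ∑ t ∈ A, w t * torusChar L k (τ t) := by
            rw [Finset.mul_sum]
            exact Finset.sum_congr rfl fun t _ => by ring
        _ = 0 := by rw [hcoef k hk, if_neg hkS, mul_zero]
  have hcont := continuous_trigPoly L T F
  rw [hrep]
  refine (eLpNorm_sum_le (fun t _ => Continuous.aestronglyMeasurable (by fun_prop)) hp).trans ?_
  simp only [eLpNorm_const_smul, eLpNorm_trigPoly_comp_add_right hL]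
  rw [← Finset.sum_mul]
  gcongr
  simp only [← ofReal_norm]
  rw [← ENNReal.ofReal_sum_of_nonneg fun t _ => norm_nonneg _]
  exact ENNReal.ofReal_le_ofReal hw

lemma exists_finset_sub_mem_of_mem_box {d : ℕ} {L : ℝ} (hL : 0 < L) {b : Fin d → ℝ}
    (hb : ∀ j, 0 < b j) (lam : Fin d → ℝ) :
    ∃ P Q : Finset (Fin d → ℤ), Q.Nonempty ∧ P.card ≤ 2 ^ d * Q.card ∧
      (∀ k : Fin d → ℤ, (∀ j, (k j : ℝ) / L ∈ Set.Icc (lam j - b j / 2) (lam j + b j / 2)) →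
        ∀ q ∈ Q, k - q ∈ P) ∧
      ∀ k : Fin d → ℤ, ∀ q ∈ Q, k - q ∈ P → ∀ j, |(k j : ℝ) / L - lam j| ≤ 3 / 2 * b j := by
  have hr : ∀ j, 0 ≤ ⌊L * b j⌋ := fun j => Int.floor_nonneg.2 (mul_pos hL (hb j)).le
  refine ⟨Fintype.piFinset fun j =>
      Finset.Icc (⌈L * (lam j - b j / 2)⌉ - ⌊L * b j⌋) ⌊L * (lam j + b j / 2)⌋,
    Fintype.piFinset fun j => Finset.Icc 0 ⌊L * b j⌋, ⟨0, by simp [hr]⟩, ?_, ?_, ?_⟩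
  · rw [Fintype.card_piFinset, Fintype.card_piFinset]
    calc _ ≤ ∏ j : Fin d, 2 * (Finset.Icc 0 ⌊L * b j⌋).card := by
          refine Finset.prod_le_prod' fun j _ => ?_
          have h1 : ⌊L * (lam j + b j / 2)⌋ - ⌈L * (lam j - b j / 2)⌉ ≤ ⌊L * b j⌋ := by
            rw [Int.le_floor]
            push_cast
            linarith [Int.floor_le (L * (lam j + b j / 2)), Int.le_ceil (L * (lam j - b j / 2))]
          have h2 := hr j
          simp only [Int.card_Icc]
          omega
      _ = _ := by simp [Finset.prod_mul_distrib]
  · intro k hk q hq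
    simp only [Fintype.mem_piFinset, Finset.mem_Icc, Pi.sub_apply] at hq ⊢
    intro j
    obtain ⟨h1, h2⟩ := hk j
    rw [le_div_iff₀' hL] at h1
    rw [div_le_iff₀' hL] at h2
    have h3 := Int.ceil_le.2 h1
    have h4 := Int.le_floor.2 h2
    have h5 := hq j
    omega
  · intro k q hq hkq j
    simp only [Fintype.mem_piFinset, Finset.mem_Icc, Pi.sub_apply] at hq hkq
    have h1 := hq j
    have h2 := hkq j
    have h3 : ⌈L * (lam j - b j / 2)⌉ ≤ k j + ⌊L * b j⌋ := by omega
    have h4 : k j - ⌊L * b j⌋ ≤ ⌊L * (lam j + b j / 2)⌋ := by omega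
    rw [Int.ceil_le] at h3
    rw [Int.le_floor] at h4
    push_cast at h3 h4
    have h5 := Int.floor_le (L * b j)
    rw [abs_le, neg_le_sub_iff_le_add, sub_le_iff_le_add, div_le_iff₀' hL, ← sub_le_iff_le_add,
      le_div_iff₀' hL]
    constructor <;> linarith

lemma trigPoly_image_sub_mul_torusChar {d : ℕ} (L : ℝ) (S : Finset (Fin d → ℤ))
    (F : (Fin d → ℤ) → ℂ) (c : Fin d → ℤ) (x : Fin d → ℝ) :
    trigPoly L (S.image fun k => k - c) (fun m => F (m + c)) x * torusChar L c x =
      trigPoly L S F x := by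
  rw [trigPoly_eq_sum_torusChar, Finset.sum_image fun _ _ _ _ h => sub_left_injective h,
    Finset.sum_mul]
  refine Finset.sum_congr rfl fun k _ => ?_
  rw [mul_assoc, ← torusChar_add, sub_add_cancel]
  rfl

/-- Shift decomposition: if `f` on `T^d_L` has Fourier support in `J_1 ∪ … ∪ J_n`, where `J_l`
are axis-parallel parallelepipeds with sides `b_1,…,b_d`, centers `λ_l` with
`|λ_{l,j} - λ_{k,j}| > 2b_j` for `l ≠ k`, and each `J_l` contains a lattice point of `(ℤ/L)^d`,
then `f(x) = Σ_l f_l(x) e^{i c_l · x}` with `c_l ∈ (ℤ/L)^d ∩ J_l`, each `f̂_l` supported in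
`[-b_1,b_1] × … × [-b_d,b_d]`, and `‖f_l‖_{L^p(T^d_L)} ≤ 6^d ‖f‖_{L^p(T^d_L)}` for `p ∈ [1,∞]`. -/
theorem stmt_8 (d n : ℕ) (hd : 1 ≤ d) (hn : 1 ≤ n) (L : ℝ) (hL : 0 < L)
    (b : Fin d → ℝ) (hb : ∀ j, 0 < b j) (lam : Fin n → Fin d → ℝ)
    (hsep : ∀ l k : Fin n, l ≠ k → ∀ j, |lam l j - lam k j| > 2 * b j)
    (hlat : ∀ l : Fin n, ∃ k : Fin d → ℤ, ∀ j,
      (k j : ℝ) / L ∈ Set.Icc (lam l j - b j / 2) (lam l j + b j / 2))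
    (T : Finset (Fin d → ℤ)) (F : (Fin d → ℤ) → ℂ)
    (hsupp : ∀ k ∈ T, ∃ l : Fin n, ∀ j,
      (k j : ℝ) / L ∈ Set.Icc (lam l j - b j / 2) (lam l j + b j / 2)) :
    ∃ (c : Fin n → Fin d → ℤ) (Tl : Fin n → Finset (Fin d → ℤ))
      (Fl : Fin n → (Fin d → ℤ) → ℂ),
      (∀ l j, ((c l j : ℝ) / L) ∈ Set.Icc (lam l j - b j / 2) (lam l j + b j / 2)) ∧
      (∀ l, ∀ k ∈ Tl l, ∀ j, |(k j : ℝ) / L| ≤ b j) ∧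
      (∀ x, trigPoly L T F x =
        ∑ l, trigPoly L (Tl l) (Fl l) x *
          Complex.exp (Complex.I * ((∑ j, ((c l j : ℝ) / L) * x j : ℝ) : ℂ))) ∧
      (∀ (l : Fin n) (p : ENNReal), 1 ≤ p →
        eLpNorm (trigPoly L (Tl l) (Fl l)) p (volume.restrict (torusCube d L)) ≤
          ENNReal.ofReal ((6 : ℝ) ^ d) *
            eLpNorm (trigPoly L T F) p (volume.restrict (torusCube d L))) := by
  classical
  have hcexp : ∀ (c : Fin d → ℤ) (x : Fin d → ℝ),
      Complex.exp (Complex.I * ((∑ j, ((c j : ℝ) / L) * x j : ℝ) : ℂ)) = torusChar L c x := by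
    intro c x
    rw [torusChar]
    congr 3
    exact Finset.sum_congr rfl fun j _ => by ring
  have hfar : ∀ l l' : Fin n, l ≠ l' → ∀ (k : Fin d → ℤ),
      (∀ j, (k j : ℝ) / L ∈ Set.Icc (lam l' j - b j / 2) (lam l' j + b j / 2)) →
      ∀ j, 3 / 2 * b j < |(k j : ℝ) / L - lam l j| := by
    intro l l' hll k hk j
    have h1 := hsep l l' hll j
    obtain ⟨h2, h3⟩ := hk j
    rcases lt_abs.1 h1 with h | h
    · exact lt_abs.2 (Or.inr (by linarith))
    · exact lt_abs.2 (Or.inl (by linarith))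
  choose c hc using hlat
  let S : Fin n → Finset (Fin d → ℤ) := fun l =>
    T.filter fun k => ∀ j, (k j : ℝ) / L ∈ Set.Icc (lam l j - b j / 2) (lam l j + b j / 2)
  have hdisj : ∀ k ∈ T, ∃ l, ∀ l', k ∈ S l' ↔ l = l' := by
    intro k hk
    obtain ⟨l, hl⟩ := hsupp k hk
    refine ⟨l, fun l' => ⟨fun h => ?_, ?_⟩⟩
    · by_contra hne
      have h1 := hfar l' l (Ne.symm hne) k hl ⟨0, hd⟩
      obtain ⟨h2, h3⟩ := (Finset.mem_filter.1 h).2 ⟨0, hd⟩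
      have h4 := hb ⟨0, hd⟩
      exact h1.not_ge (abs_le.2 ⟨by linarith, by linarith⟩)
    · rintro rfl
      exact Finset.mem_filter.2 ⟨hk, hl⟩
  refine ⟨c, fun l => (S l).image fun k => k - c l, fun l m => F (m + c l), hc, ?_, ?_, ?_⟩
  · intro l k hk j
    obtain ⟨m, hm, rfl⟩ := Finset.mem_image.1 hk
    obtain ⟨h1, h2⟩ := (Finset.mem_filter.1 hm).2 j
    obtain ⟨h3, h4⟩ := hc l j
    rw [Pi.sub_apply, Int.cast_sub, sub_div, abs_le]
    constructor <;> linarith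
  · intro x
    simp only [hcexp, trigPoly_image_sub_mul_torusChar]
    simp only [trigPoly_eq_sum_torusChar, S, Finset.sum_filter]
    rw [Finset.sum_comm]
    refine Finset.sum_congr rfl fun k hk => ?_
    obtain ⟨l, hl⟩ := hdisj k hk
    simp only [S, Finset.mem_filter, hk, true_and] at hl
    simp only [hl, Finset.sum_ite_eq, Finset.mem_univ, if_true]
  · intro l p hp
    obtain ⟨P, Q, hQ, hPQ, hin, hout⟩ := exists_finset_sub_mem_of_mem_box hL hb (lam l)
    have hnorm : eLpNorm (trigPoly L ((S l).image fun k => k - c l) fun m => F (m + c l)) p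
        (volume.restrict (torusCube d L)) =
        eLpNorm (trigPoly L (S l) F) p (volume.restrict (torusCube d L)) := by
      refine eLpNorm_congr_norm_ae (Filter.Eventually.of_forall fun x => ?_)
      rw [← trigPoly_image_sub_mul_torusChar L (S l) F (c l) x, norm_mul, norm_torusChar, mul_one]
    rw [hnorm]
    refine (eLpNorm_trigPoly_subset_le hL (Finset.filter_subset _ _) F hQ
      (fun k hk => hin k (Finset.mem_filter.1 hk).2) (fun k hk hkS q hq hkq => ?_) hp).trans ?_
    · obtain ⟨l', hl'⟩ := hsupp k hk
      have hne : l ≠ l' := by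
        rintro rfl
        exact hkS (Finset.mem_filter.2 ⟨hk, hl'⟩)
      exact (hfar l l' hne k hl' ⟨0, hd⟩).not_ge (hout k q hq hkq ⟨0, hd⟩)
    · gcongr
      have hQ0 : (0 : ℝ) < Q.card := by exact_mod_cast hQ.card_pos
      have hPQ' : (P.card : ℝ) ≤ 2 ^ d * Q.card := by exact_mod_cast hPQ
      have h1 : (1 : ℝ) ≤ 6 ^ d := one_le_pow₀ (by norm_num)
      have h2 : (2 : ℝ) ^ d ≤ 6 ^ d := by gcongr; norm_num
      rw [div_le_iff₀ (by positivity)]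
      nlinarith
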